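/- arXiv:1805.05998 — 2 statements merged into one kernel-verified Lean document; each statement's English description precedes it below -/
import Mathlib

section
/- Let A be a separable unital C*-algebra with compact generating set K, let a, b ∈ A and λ ∈ ℂ. Then: (1) ω^K_{a+λ·1} = ω^K_a = ω^K_{a*}; (2) ω^K_a = 0 (the zero function) if and only if a is a scalar multiple of the unit of A; (3) ω^K_{λa} = |λ|·ω^K_a; (4) ω^K_{a+b} ≤ ω^K_a + ω^K_b pointwise; (5) ω^K_{ab} ≤ ‖a‖·ω^K_b + ‖b‖·ω^K_a pointwise. -/
noncomputable section

abbrev H2 : Type := lp (fun _ : ℕ => ℂ) 2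
abbrev BH : Type := H2 →L[ℂ] H2

abbrev RepSp (A : Type*) [CStarAlgebra A] := A →⋆ₐ[ℂ] BH

def Generates {A : Type*} [CStarAlgebra A] (K : Set A) : Prop :=
  (StarAlgebra.adjoin ℂ K).topologicalClosure = ⊤

def dRep {A : Type*} [CStarAlgebra A] (K : Set A) (π₁ π₂ : RepSp A) : ℝ :=
  ⨆ a ∈ K, ‖π₁ a - π₂ a‖

/-- A modulus of continuity: a continuous, nondecreasing, concave function
`[0,∞) → [0,∞)` vanishing at `0`. -/
def IsModulus (ω : ℝ → ℝ) : Prop :=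
  ContinuousOn ω (Set.Ici 0) ∧ MonotoneOn ω (Set.Ici 0) ∧
    ConcaveOn ℝ (Set.Ici 0) ω ∧ ω 0 = 0 ∧ ∀ t ∈ Set.Ici (0 : ℝ), 0 ≤ ω t

/-- `f^K_a(t) = sup {‖π(a) - π'(a)‖ : d_K(π,π') ≤ t}`. -/
def fModPt {A : Type*} [CStarAlgebra A] (K : Set A) (a : A) (t : ℝ) : ℝ :=
  sSup {r : ℝ | ∃ π π' : RepSp A, dRep K π π' ≤ t ∧ r = ‖π a - π' a‖}

/-- `ω^K_a(t) = inf {ω(t) : ω ∈ Ω, ω ≥ f^K_a on [0,∞)}`. -/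
def omegaPt {A : Type*} [CStarAlgebra A] (K : Set A) (a : A) (t : ℝ) : ℝ :=
  sInf {y : ℝ | ∃ ω : ℝ → ℝ, IsModulus ω ∧
    (∀ s ∈ Set.Ici (0 : ℝ), fModPt K a s ≤ ω s) ∧ y = ω t}

section Representations

open scoped InnerProductSpace ComplexOrder

/-- Every nonzero positive element is detected by a positive functional. -/
theorem exists_positiveLinearMap_pos {A : Type*} [CStarAlgebra A] [PartialOrder A]
    [StarOrderedRing A] {h : A} (hh : 0 ≤ h) (hne : h ≠ 0) :
    ∃ f : A →ₚ[ℂ] ℂ, f h ≠ 0 := by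
  obtain ⟨φ, hφ, hφh⟩ := (ProperCone.positive ℝ A).hyperplane_separation_point (x₀ := -h) (by
    intro hmem
    exact hne (le_antisymm (by simpa using hmem) hh))
  have hsm (c : ℝ) (x : A) : φ (c • x) = c * φ x := by simp
  let g : A →ₗ[ℂ] ℂ :=
    { toFun := fun a => (φ (realPart a : A) : ℂ) + Complex.I * (φ (imaginaryPart a : A) : ℂ)
      map_add' := fun x y => by
        simp only [map_add, AddSubgroup.coe_add, Complex.ofReal_add]
        ring
      map_smul' := fun c x => by
        simp only [realPart_smul, imaginaryPart_smul, AddSubgroupClass.coe_sub,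
          AddSubgroup.coe_add, selfAdjoint.val_smul, map_sub, map_add, hsm, RingHom.id_apply,
          smul_eq_mul, Complex.ofReal_sub, Complex.ofReal_add, Complex.ofReal_mul]
        conv_rhs => rw [← Complex.re_add_im c]
        linear_combination (-(c.im : ℂ) * (φ (imaginaryPart x : A) : ℂ)) * Complex.I_sq }
  have hg {x : A} (hx : 0 ≤ x) : g x = (φ x : ℂ) := by
    have hs := IsSelfAdjoint.of_nonneg hx
    change (φ (realPart x : A) : ℂ) + Complex.I * (φ (imaginaryPart x : A) : ℂ) = _
    rw [hs.coe_realPart, hs.imaginaryPart]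
    simp
  refine ⟨PositiveLinearMap.mk₀ g fun x hx => ?_, ?_⟩
  · rw [hg hx]
    exact_mod_cast hφ x hx
  · change g h ≠ 0
    rw [hg hh]
    simp only [map_neg] at hφh
    exact_mod_cast (by linarith : 0 < φ h).ne'

/-- The GNS space of a separable C⋆-algebra is separable. -/
theorem separableSpace_gns {A : Type*} [CStarAlgebra A] [PartialOrder A] [StarOrderedRing A]
    [TopologicalSpace.SeparableSpace A] (f : A →ₚ[ℂ] ℂ) :
    TopologicalSpace.SeparableSpace f.GNS := by
  obtain ⟨C, hC⟩ := f.exists_norm_apply_le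
  let T : A →L[ℂ] f.PreGNS := f.toPreGNS.toLinearMap.mkContinuous (√C) fun x => by
    rw [PositiveLinearMap.preGNS_norm_def, ← Real.sqrt_sq (norm_nonneg x),
      ← Real.sqrt_mul C.coe_nonneg]
    refine Real.sqrt_le_sqrt ((Complex.re_le_norm _).trans ((hC _).trans_eq ?_))
    simp [CStarRing.norm_star_mul_self, sq]
  have : TopologicalSpace.SeparableSpace f.PreGNS :=
    (Function.Surjective.denseRange (f := T) f.toPreGNS.surjective).separableSpace T.continuous
  infer_instance

theorem Orthonormal.countable_of_separableSpace {H ι : Type*} [NormedAddCommGroup H]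
    [InnerProductSpace ℂ H] [TopologicalSpace.SeparableSpace H] {v : ι → H}
    (hv : Orthonormal ℂ v) : Countable ι := by
  refine Pairwise.countable_of_isOpen_disjoint (s := fun i => Metric.ball (v i) (1 / 2)) ?_
    (fun _ => Metric.isOpen_ball) (fun _ => Metric.nonempty_ball.2 (by norm_num))
  intro i j hij
  refine Metric.ball_disjoint_ball ?_
  have h : ‖v i - v j‖ ^ 2 = 2 := by
    rw [norm_sub_sq (𝕜 := ℂ), hv.1, hv.1, hv.2 hij]
    norm_num
  rw [dist_eq_norm]
  nlinarith [norm_nonneg (v i - v j)]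

theorem LinearIsometryEquiv.exists_injective_starAlgHom {H L : Type*} [NormedAddCommGroup H]
    [InnerProductSpace ℂ H] [CompleteSpace H] [NormedAddCommGroup L] [InnerProductSpace ℂ L]
    [CompleteSpace L] (U : H ≃ₗᵢ[ℂ] L) :
    ∃ Φ : (H →L[ℂ] H) →⋆ₐ[ℂ] (L →L[ℂ] L), Function.Injective Φ :=
  ⟨{ toFun := U.conjStarAlgEquiv
     map_one' := map_one _
     map_mul' := map_mul _
     map_zero' := by ext x; simp
     map_add' := fun S T => by ext x; simp
     commutes' := fun c => by ext x; simp [Algebra.algebraMap_eq_smul_one]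
     map_star' := map_star _ }, U.conjStarAlgEquiv.injective⟩

/-- The countably infinite Hilbert sum of copies of `H`. -/
abbrev Amp (H : Type*) [NormedAddCommGroup H] [InnerProductSpace ℂ H] : Type _ :=
  lp (fun _ : ℕ => H) 2

section Amplification

variable {H : Type*} [NormedAddCommGroup H] [InnerProductSpace ℂ H]

theorem memℓp_comp_clm (T : H →L[ℂ] H) (x : Amp H) : Memℓp (fun n => T (x n)) 2 :=
  ((lp.memℓp x).norm.const_mul ‖T‖).mono fun _ => T.le_opNorm _

/-- The diagonal operator acting by `T` on each summand. -/
def ampOp (T : H →L[ℂ] H) : Amp H →L[ℂ] Amp H :=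
  LinearMap.mkContinuous
    { toFun := fun x => ⟨fun n => T (x n), memℓp_comp_clm T x⟩
      map_add' := fun x y => by ext n; exact map_add T _ _
      map_smul' := fun c x => by ext n; simp } ‖T‖ fun x => by
    calc _ ≤ ‖(‖T‖ : ℂ) • x‖ := lp.norm_mono two_ne_zero fun n => by
          rw [lp.coeFn_smul, Pi.smul_apply, norm_smul, Complex.norm_real, norm_norm]
          exact T.le_opNorm (x n)
      _ = ‖T‖ * ‖x‖ := by rw [norm_smul, Complex.norm_real, norm_norm]

@[simp]
theorem ampOp_apply (T : H →L[ℂ] H) (x : Amp H) (n : ℕ) : ampOp T x n = T (x n) := rfl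

/-- Amplification as a unital ⋆-homomorphism. -/
def ampHom [CompleteSpace H] : (H →L[ℂ] H) →⋆ₐ[ℂ] (Amp H →L[ℂ] Amp H) where
  toFun := ampOp
  map_one' := by ext x n; simp
  map_mul' S T := by ext x n; simp
  map_zero' := by ext x n; simp
  map_add' S T := by ext x n; simp
  commutes' c := by ext x n; simp [Algebra.algebraMap_eq_smul_one]
  map_star' T := by
    refine (ContinuousLinearMap.eq_adjoint_iff _ _).2 fun x y => ?_
    simp [lp.inner_eq_tsum, ContinuousLinearMap.star_eq_adjoint,
      ContinuousLinearMap.adjoint_inner_left]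

theorem ampHom_injective [CompleteSpace H] :
    Function.Injective (ampHom : (H →L[ℂ] H) →⋆ₐ[ℂ] (Amp H →L[ℂ] Amp H)) := by
  intro S T hST
  ext v
  have := congr(($hST (lp.single 2 0 v)) 0)
  simpa [ampHom] using this

theorem nonempty_amp_linearIsometryEquiv [CompleteSpace H] [Nontrivial H]
    [TopologicalSpace.SeparableSpace H] : Nonempty (Amp H ≃ₗᵢ[ℂ] H2) := by
  classical
  obtain ⟨w, b, -⟩ := exists_hilbertBasis ℂ H
  have : Countable w := b.orthonormal.countable_of_separableSpace
  have : Nonempty w := by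
    by_contra hw
    rw [not_nonempty_iff] at hw
    obtain ⟨v, hv⟩ := exists_ne (0 : H)
    exact hv (b.repr.injective (by ext i; exact hw.elim i))
  obtain ⟨e⟩ : Nonempty (ℕ ≃ ℕ × w) := nonempty_equiv_of_countable
  let v : ℕ → Amp H := fun k => lp.single 2 (e k).1 (b (e k).2)
  have hv : Orthonormal ℂ v := by
    rw [orthonormal_iff_ite]
    intro i j
    simp only [v, lp.inner_single_left, lp.single_apply, Pi.single_apply]
    have hb := orthonormal_iff_ite.1 b.orthonormal (e i).2 (e j).2
    by_cases hij : i = j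
    · subst hij; simpa using hb
    · have : e i ≠ e j := e.injective.ne hij
      split_ifs with h
      · rw [hb, if_neg (fun h2 => this (Prod.ext h h2))]
      · simp
  refine ⟨(HilbertBasis.mkOfOrthogonalEqBot hv ?_).repr⟩
  rw [eq_bot_iff]
  intro x hx
  rw [Submodule.mem_bot]
  ext n
  apply b.repr.injective
  ext i
  have := Submodule.inner_right_of_mem_orthogonal
    (Submodule.subset_span (Set.mem_range_self (e.symm (n, i)))) hx
  simpa [v, lp.inner_single_left, b.repr_apply_apply] using this

theorem exists_injective_starAlgHom_clm [CompleteSpace H] [Nontrivial H]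
    [TopologicalSpace.SeparableSpace H] :
    ∃ Φ : (H →L[ℂ] H) →⋆ₐ[ℂ] BH, Function.Injective Φ := by
  obtain ⟨U⟩ := nonempty_amp_linearIsometryEquiv (H := H)
  obtain ⟨Φ, hΦ⟩ := U.exists_injective_starAlgHom
  exact ⟨Φ.comp ampHom, hΦ.comp ampHom_injective⟩

end Amplification

/-- A separable unital C⋆-algebra has enough representations on `ℓ²`. -/
theorem exists_repSp_apply_ne_zero {A : Type*} [CStarAlgebra A]
    [TopologicalSpace.SeparableSpace A] {x : A} (hx : x ≠ 0) : ∃ π : RepSp A, π x ≠ 0 := by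
  let _ := CStarAlgebra.spectralOrder A
  have := CStarAlgebra.spectralOrderedRing A
  obtain ⟨f, hf⟩ := exists_positiveLinearMap_pos (star_mul_self_nonneg x)
    (by simpa [CStarRing.star_mul_self_eq_zero_iff] using hx)
  have := separableSpace_gns f
  have hne : f.gnsStarAlgHom x ≠ 0 := by
    intro h0
    have h1 : f.gnsStarAlgHom x (f.toPreGNS 1 : f.GNS) = 0 := by rw [h0]; rfl
    have h2 : ‖f.toPreGNS x‖ = 0 := by
      simpa using congr(‖$h1‖)
    apply hf
    have := f.preGNS_norm_sq (f.toPreGNS x)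
    rw [h2] at this
    simpa using this.symm
  have : Nontrivial f.GNS := by
    by_contra hn
    rw [not_nontrivial_iff_subsingleton] at hn
    exact hne (Subsingleton.elim _ _)
  obtain ⟨Φ, hΦ⟩ := exists_injective_starAlgHom_clm (H := f.GNS)
  exact ⟨Φ.comp f.gnsStarAlgHom, fun h => hne (hΦ (h.trans (map_zero Φ).symm))⟩

/-- An operator commuting with all unitaries is scalar. -/
theorem exists_eq_smul_one_of_conj_eq {T : BH} (hT : ∀ u ∈ unitary BH, u * T * star u = T) :
    ∃ c : ℂ, T = c • (1 : BH) := by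
  have hc : T ∈ Subalgebra.center ℂ BH := by
    rw [Subalgebra.mem_center_iff]
    intro S
    have hS : S ∈ Submodule.span ℂ (unitary BH : Set BH) := by
      rw [CStarAlgebra.span_unitary]; trivial
    induction hS using Submodule.span_induction with
    | mem u hu =>
      nth_rw 2 [← hT u hu]
      rw [mul_assoc, Unitary.star_mul_self_of_mem hu, mul_one]
    | zero => simp
    | add x y _ _ hx hy => rw [add_mul, mul_add, hx, hy]
    | smul c x _ hx => rw [smul_mul_assoc, mul_smul_comm, hx]
  rw [Algebra.IsCentral.center_eq_bot, Algebra.mem_bot] at hc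
  obtain ⟨c, rfl⟩ := hc
  exact ⟨c, Algebra.algebraMap_eq_smul_one c⟩

/-- An element on which all representations agree is scalar. -/
theorem exists_eq_smul_one_of_forall_repSp_eq {A : Type*} [CStarAlgebra A]
    [TopologicalSpace.SeparableSpace A] {a : A} (h : ∀ π π' : RepSp A, π a = π' a) :
    ∃ c : ℂ, a = c • (1 : A) := by
  rcases subsingleton_or_nontrivial A with _ | _
  · exact ⟨0, Subsingleton.elim _ _⟩
  obtain ⟨π₀, -⟩ := exists_repSp_apply_ne_zero (one_ne_zero (α := A))
  obtain ⟨c, hc⟩ : ∃ c : ℂ, π₀ a = c • (1 : BH) := by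
    refine exists_eq_smul_one_of_conj_eq fun u hu => ?_
    exact h ((Unitary.conjStarAlgAut ℂ BH ⟨u, hu⟩ : BH →⋆ₐ[ℂ] BH).comp π₀) π₀
  refine ⟨c, ?_⟩
  by_contra hne
  obtain ⟨π, hπ⟩ := exists_repSp_apply_ne_zero (sub_ne_zero.2 hne)
  apply hπ
  rw [map_sub, map_smul, map_one, h π π₀, hc, sub_self]

end Representations

section Moduli

theorem isModulus_zero : IsModulus fun _ => 0 :=
  ⟨continuousOn_const, monotoneOn_const, concaveOn_const 0 (convex_Ici 0), rfl, fun _ _ => le_rfl⟩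

theorem IsModulus.add {ω₁ ω₂ : ℝ → ℝ} (h₁ : IsModulus ω₁) (h₂ : IsModulus ω₂) :
    IsModulus fun t => ω₁ t + ω₂ t :=
  ⟨h₁.1.add h₂.1, h₁.2.1.add h₂.2.1, h₁.2.2.1.add h₂.2.2.1,
    by simp [h₁.2.2.2.1, h₂.2.2.2.1],
    fun t ht => add_nonneg (h₁.2.2.2.2 t ht) (h₂.2.2.2.2 t ht)⟩

theorem IsModulus.const_mul {ω : ℝ → ℝ} (h : IsModulus ω) {p : ℝ} (hp : 0 ≤ p) :
    IsModulus fun t => p * ω t :=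
  ⟨continuousOn_const.mul h.1, fun _ hs _ ht hst => mul_le_mul_of_nonneg_left (h.2.1 hs ht hst) hp,
    h.2.2.1.smul hp, by simp [h.2.2.2.1], fun t ht => mul_nonneg hp (h.2.2.2.2 t ht)⟩

/-- The infimum of the affine functions `t ↦ 1 / (n + 1) + C n * t` is a modulus of continuity. -/
theorem isModulus_iInf_affine {C : ℕ → ℝ} (hC : ∀ n, 0 ≤ C n) :
    IsModulus fun t => ⨅ n : ℕ, (1 / ((n : ℝ) + 1) + C n * t) := by
  set ω : ℝ → ℝ := fun t => ⨅ n : ℕ, (1 / ((n : ℝ) + 1) + C n * t) with hω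
  have hnn (t : ℝ) (ht : 0 ≤ t) (n : ℕ) : 0 ≤ 1 / ((n : ℝ) + 1) + C n * t := by
    have := mul_nonneg (hC n) ht
    positivity
  have hle (t : ℝ) (ht : 0 ≤ t) (n : ℕ) : ω t ≤ 1 / ((n : ℝ) + 1) + C n * t :=
    ciInf_le ⟨0, by rintro _ ⟨m, rfl⟩; exact hnn t ht m⟩ n
  have hω0 (t : ℝ) (ht : 0 ≤ t) : 0 ≤ ω t := le_ciInf (hnn t ht)
  have hmono : MonotoneOn ω (Set.Ici 0) := fun s hs t ht hst => le_ciInf fun n =>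
    (hle s hs n).trans (by gcongr; exact hC n)
  have hconc : ConcaveOn ℝ (Set.Ici 0) ω := by
    refine ⟨convex_Ici 0, fun s hs t ht p q hp hq hpq => le_ciInf fun n => ?_⟩
    simp only [smul_eq_mul]
    have h₁ := mul_le_mul_of_nonneg_left (hle s hs n) hp
    have h₂ := mul_le_mul_of_nonneg_left (hle t ht n) hq
    calc _ ≤ _ := add_le_add h₁ h₂
      _ = (p + q) * (1 / ((n : ℝ) + 1)) + C n * (p * s + q * t) := by ring
      _ = _ := by rw [hpq, one_mul]
  have hzero : ω 0 = 0 := by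
    refine le_antisymm (le_of_forall_pos_le_add fun ε hε => ?_) (hω0 0 le_rfl)
    obtain ⟨n, hn⟩ := exists_nat_one_div_lt hε
    have := hle 0 le_rfl n
    linarith
  refine ⟨fun t ht => ?_, hmono, hconc, hzero, hω0⟩
  rcases (show (0 : ℝ) ≤ t from ht).eq_or_lt with rfl | htpos
  · rw [Metric.continuousWithinAt_iff]
    intro ε hε
    obtain ⟨n, hn⟩ := exists_nat_one_div_lt (half_pos hε)
    have hCn := hC n
    refine ⟨ε / 2 / (C n + 1), by positivity, fun {s} hs hsd => ?_⟩
    have hs0 : 0 ≤ s := hs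
    rw [Real.dist_eq, sub_zero, abs_of_nonneg hs0, lt_div_iff₀ (by positivity)] at hsd
    rw [Real.dist_eq, hzero, sub_zero, abs_of_nonneg (hω0 s hs0)]
    nlinarith [hle s hs0 n]
  · have hint : ContinuousOn ω (Set.Ioi 0) := by
      simpa using hconc.continuousOn_interior
    exact (hint.continuousAt (Ioi_mem_nhds htpos)).continuousWithinAt

variable {A : Type*} [CStarAlgebra A] {K : Set A}

theorem norm_repSp_apply_le (π : RepSp A) (x : A) : ‖π x‖ ≤ ‖x‖ :=
  NonUnitalStarAlgHom.norm_apply_le π x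

theorem norm_repSp_sub_le (π π' : RepSp A) (x : A) : ‖π x - π' x‖ ≤ 2 * ‖x‖ := by
  have := norm_sub_le (π x) (π' x)
  linarith [norm_repSp_apply_le π x, norm_repSp_apply_le π' x]

theorem norm_repSp_mul_sub_le (π π' : RepSp A) (x y : A) :
    ‖π (x * y) - π' (x * y)‖ ≤ ‖x‖ * ‖π y - π' y‖ + ‖y‖ * ‖π x - π' x‖ := by
  have h : π (x * y) - π' (x * y) = π x * (π y - π' y) + (π x - π' x) * π' y := by
    rw [map_mul, map_mul]; noncomm_ring
  rw [h]
  refine (norm_add_le _ _).trans (add_le_add ?_ ?_)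
  · exact (norm_mul_le _ _).trans (by gcongr; exact norm_repSp_apply_le π x)
  · refine (norm_mul_le _ _).trans ?_
    rw [mul_comm]
    gcongr
    exact norm_repSp_apply_le π' y

theorem norm_repSp_star_sub (π π' : RepSp A) (x : A) :
    ‖π (star x) - π' (star x)‖ = ‖π x - π' x‖ := by
  rw [map_star, map_star, ← star_sub, norm_star]

theorem dRep_nonneg (π π' : RepSp A) : 0 ≤ dRep K π π' :=
  Real.iSup_nonneg fun _ => Real.iSup_nonneg fun _ => norm_nonneg _

theorem norm_sub_le_dRep (hK : IsCompact K) {x : A} (hx : x ∈ K) (π π' : RepSp A) :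
    ‖π x - π' x‖ ≤ dRep K π π' := by
  obtain ⟨R, hR⟩ := hK.isBounded.exists_norm_le
  have hR0 : 0 ≤ R := (norm_nonneg x).trans (hR x hx)
  refine le_ciSup_of_le ⟨2 * R, ?_⟩ x (le_ciSup_of_le ⟨2 * R, ?_⟩ hx le_rfl)
  · rintro _ ⟨y, rfl⟩
    refine Real.iSup_le (fun hy => ?_) (by positivity)
    linarith [norm_repSp_sub_le π π' y, hR y hy]
  · rintro _ ⟨hy, rfl⟩
    linarith [norm_repSp_sub_le π π' x, hR x hx]

theorem norm_sub_le_fModPt {a : A} {t : ℝ} {π π' : RepSp A} (h : dRep K π π' ≤ t) :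
    ‖π a - π' a‖ ≤ fModPt K a t :=
  le_csSup ⟨2 * ‖a‖, by rintro _ ⟨π, π', -, rfl⟩; exact norm_repSp_sub_le π π' a⟩ ⟨π, π', h, rfl⟩

theorem fModPt_nonneg (a : A) (t : ℝ) : 0 ≤ fModPt K a t :=
  Real.sSup_nonneg (by rintro _ ⟨π, π', -, rfl⟩; exact norm_nonneg _)

theorem fModPt_le {a : A} {t B : ℝ} (hB : 0 ≤ B)
    (h : ∀ π π' : RepSp A, dRep K π π' ≤ t → ‖π a - π' a‖ ≤ B) : fModPt K a t ≤ B :=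
  Real.sSup_le (by rintro _ ⟨π, π', hd, rfl⟩; exact h π π' hd) hB

/-- Elements of the ⋆-algebra generated by `K` give functions on representations that are Lipschitz
for `dRep K`. -/
theorem exists_lipschitz_of_mem_adjoin (hK : IsCompact K) {x : A}
    (hx : x ∈ StarAlgebra.adjoin ℂ K) :
    ∃ C : ℝ, 0 ≤ C ∧ ∀ π π' : RepSp A, ‖π x - π' x‖ ≤ C * dRep K π π' := by
  induction hx using StarAlgebra.adjoin_induction with
  | mem x hx => exact ⟨1, zero_le_one, fun π π' => by
      rw [one_mul]; exact norm_sub_le_dRep hK hx π π'⟩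
  | algebraMap r => exact ⟨0, le_rfl, fun π π' => by simp [AlgHomClass.commutes]⟩
  | add x y _ _ hx hy =>
    obtain ⟨C, hC, hx⟩ := hx
    obtain ⟨D, hD, hy⟩ := hy
    refine ⟨C + D, by positivity, fun π π' => ?_⟩
    rw [map_add, map_add, add_sub_add_comm, add_mul]
    exact (norm_add_le _ _).trans (add_le_add (hx π π') (hy π π'))
  | mul x y _ _ hx hy =>
    obtain ⟨C, hC, hx⟩ := hx
    obtain ⟨D, hD, hy⟩ := hy
    refine ⟨‖x‖ * D + ‖y‖ * C, by positivity, fun π π' => ?_⟩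
    refine (norm_repSp_mul_sub_le π π' x y).trans ?_
    rw [add_mul, mul_assoc, mul_assoc]
    gcongr
    exacts [hy π π', hx π π']
  | star x _ hx =>
    obtain ⟨C, hC, hx⟩ := hx
    exact ⟨C, hC, fun π π' => by rw [norm_repSp_star_sub]; exact hx π π'⟩

theorem exists_norm_sub_le_add_mul_dRep (hK : IsCompact K) (hgen : Generates K) (a : A) {ε : ℝ}
    (hε : 0 < ε) :
    ∃ C : ℝ, 0 ≤ C ∧ ∀ π π' : RepSp A, ‖π a - π' a‖ ≤ ε + C * dRep K π π' := by
  have ha : a ∈ closure (StarAlgebra.adjoin ℂ K : Set A) := by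
    rw [← StarSubalgebra.topologicalClosure_coe, hgen]
    trivial
  obtain ⟨x, hx, hax⟩ := Metric.mem_closure_iff.1 ha (ε / 2) (half_pos hε)
  obtain ⟨C, hC, hxC⟩ := exists_lipschitz_of_mem_adjoin hK hx
  refine ⟨C, hC, fun π π' => ?_⟩
  have h : π a - π' a = (π (a - x) - π' (a - x)) + (π x - π' x) := by
    rw [map_sub, map_sub]; abel
  rw [h]
  rw [dist_eq_norm] at hax
  linarith [norm_add_le (π (a - x) - π' (a - x)) (π x - π' x), norm_repSp_sub_le π π' (a - x),
    hxC π π']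

theorem exists_isModulus_ge_fModPt (hK : IsCompact K) (hgen : Generates K) (a : A) :
    ∃ ω : ℝ → ℝ, IsModulus ω ∧ ∀ s ∈ Set.Ici (0 : ℝ), fModPt K a s ≤ ω s := by
  choose C hC h using fun n : ℕ =>
    exists_norm_sub_le_add_mul_dRep hK hgen a (Nat.one_div_pos_of_nat (α := ℝ) (n := n))
  refine ⟨_, isModulus_iInf_affine hC, fun s hs => ?_⟩
  have hω := (isModulus_iInf_affine hC).2.2.2.2 s hs
  refine fModPt_le hω fun π π' hd => le_ciInf fun n => (h n π π').trans ?_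
  gcongr
  exact hC n

theorem omegaPt_nonneg (a : A) {t : ℝ} (ht : 0 ≤ t) : 0 ≤ omegaPt K a t :=
  Real.sInf_nonneg (by rintro _ ⟨ω, hω, -, rfl⟩; exact hω.2.2.2.2 t ht)

theorem omegaPt_le {a : A} {ω : ℝ → ℝ} (hω : IsModulus ω)
    (h : ∀ s ∈ Set.Ici (0 : ℝ), fModPt K a s ≤ ω s) {t : ℝ} (ht : 0 ≤ t) :
    omegaPt K a t ≤ ω t :=
  csInf_le ⟨0, by rintro _ ⟨ω, hω, -, rfl⟩; exact hω.2.2.2.2 t ht⟩ ⟨ω, hω, h, rfl⟩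

theorem le_omegaPt (hK : IsCompact K) (hgen : Generates K) {a : A} {t B : ℝ}
    (h : ∀ ω : ℝ → ℝ, IsModulus ω → (∀ s ∈ Set.Ici (0 : ℝ), fModPt K a s ≤ ω s) → B ≤ ω t) :
    B ≤ omegaPt K a t := by
  obtain ⟨ω, hω, hle⟩ := exists_isModulus_ge_fModPt hK hgen a
  exact le_csInf ⟨_, ω, hω, hle, rfl⟩ (by rintro _ ⟨ω, hω, hle, rfl⟩; exact h ω hω hle)

/-- A linear estimate between differences of representations passes to the moduli. -/
theorem omegaPt_le_add (hK : IsCompact K) (hgen : Generates K) {a b c : A} {p q : ℝ}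
    (hp : 0 ≤ p) (hq : 0 ≤ q)
    (h : ∀ π π' : RepSp A, ‖π c - π' c‖ ≤ p * ‖π a - π' a‖ + q * ‖π b - π' b‖)
    {t : ℝ} (ht : 0 ≤ t) :
    omegaPt K c t ≤ p * omegaPt K a t + q * omegaPt K b t := by
  have key {ω₁ ω₂ : ℝ → ℝ} (h₁ : IsModulus ω₁) (hle₁ : ∀ s ∈ Set.Ici (0 : ℝ), fModPt K a s ≤ ω₁ s)
      (h₂ : IsModulus ω₂) (hle₂ : ∀ s ∈ Set.Ici (0 : ℝ), fModPt K b s ≤ ω₂ s) :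
      omegaPt K c t ≤ p * ω₁ t + q * ω₂ t := by
    have hm := (h₁.const_mul hp).add (h₂.const_mul hq)
    refine omegaPt_le hm (fun s hs => fModPt_le (hm.2.2.2.2 s hs) fun π π' hd => ?_) ht
    refine (h π π').trans ?_
    gcongr
    exacts [(norm_sub_le_fModPt hd).trans (hle₁ s hs), (norm_sub_le_fModPt hd).trans (hle₂ s hs)]
  have approx (x : A) {δ : ℝ} (hδ : 0 < δ) : ∃ ω : ℝ → ℝ, IsModulus ω ∧
      (∀ s ∈ Set.Ici (0 : ℝ), fModPt K x s ≤ ω s) ∧ ω t ≤ omegaPt K x t + δ := by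
    by_contra! hcon
    have := le_omegaPt (t := t) hK hgen fun ω hω hle => (hcon ω hω hle).le
    linarith
  refine le_of_forall_pos_le_add fun ε hε => ?_
  have hδ : 0 < ε / (p + q + 1) := by positivity
  obtain ⟨ω₁, h₁, hle₁, ht₁⟩ := approx a hδ
  obtain ⟨ω₂, h₂, hle₂, ht₂⟩ := approx b hδ
  calc omegaPt K c t ≤ p * ω₁ t + q * ω₂ t := key h₁ hle₁ h₂ hle₂
    _ ≤ p * (omegaPt K a t + ε / (p + q + 1)) + q * (omegaPt K b t + ε / (p + q + 1)) := by gcongr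
    _ = p * omegaPt K a t + q * omegaPt K b t + (p + q) * (ε / (p + q + 1)) := by ring
    _ ≤ p * omegaPt K a t + q * omegaPt K b t + ε := by
      gcongr
      rw [mul_div_assoc', div_le_iff₀ (by positivity)]
      nlinarith

theorem omegaPt_le_mul (hK : IsCompact K) (hgen : Generates K) {a c : A} {p : ℝ} (hp : 0 ≤ p)
    (h : ∀ π π' : RepSp A, ‖π c - π' c‖ ≤ p * ‖π a - π' a‖) {t : ℝ} (ht : 0 ≤ t) :
    omegaPt K c t ≤ p * omegaPt K a t := by
  simpa using omegaPt_le_add hK hgen (b := a) hp le_rfl (by simpa using h) ht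

theorem omegaPt_congr {a c : A} (h : ∀ π π' : RepSp A, ‖π c - π' c‖ = ‖π a - π' a‖) (t : ℝ) :
    omegaPt K c t = omegaPt K a t := by
  simp only [omegaPt, fModPt, h]

theorem repSp_eq_of_omegaPt_eq_zero (hK : IsCompact K) (hgen : Generates K) {a : A}
    (h : ∀ t : ℝ, 0 ≤ t → omegaPt K a t = 0) (π π' : RepSp A) : π a = π' a := by
  have hd := dRep_nonneg (K := K) π π'
  have h0 : ‖π a - π' a‖ ≤ omegaPt K a (dRep K π π') :=
    (norm_sub_le_fModPt le_rfl).trans (le_omegaPt hK hgen fun ω _ hle => hle _ hd)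
  rw [h _ hd] at h0
  exact sub_eq_zero.1 (norm_le_zero_iff.1 h0)

theorem norm_repSp_smul_sub (π π' : RepSp A) (c : ℂ) (x : A) :
    ‖π (c • x) - π' (c • x)‖ = ‖c‖ * ‖π x - π' x‖ := by
  rw [map_smul, map_smul, ← smul_sub, norm_smul]

theorem omegaPt_smul (hK : IsCompact K) (hgen : Generates K) (c : ℂ) (a : A) {t : ℝ} (ht : 0 ≤ t) :
    omegaPt K (c • a) t = ‖c‖ * omegaPt K a t := by
  refine le_antisymm (omegaPt_le_mul hK hgen (norm_nonneg c)
    (fun π π' => (norm_repSp_smul_sub π π' c a).le) ht) ?_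
  rcases eq_or_ne c 0 with rfl | hc
  · simpa using omegaPt_nonneg (K := K) (0 : A) ht
  · have hc' : 0 < ‖c‖ := norm_pos_iff.2 hc
    have := omegaPt_le_mul hK hgen (c := a) (a := c • a) (inv_nonneg.2 (norm_nonneg c))
      (fun π π' => by rw [norm_repSp_smul_sub, inv_mul_cancel_left₀ hc'.ne']) ht
    rwa [← div_eq_inv_mul, le_div_iff₀' hc'] at this

end Moduli

theorem stmt8 (A : Type*) [CStarAlgebra A] [TopologicalSpace.SeparableSpace A]
    (K : Set A) (hK : IsCompact K) (hgen : Generates K) (a b : A) (lam : ℂ) :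
    (∀ t : ℝ, 0 ≤ t →
        omegaPt K (a + lam • (1 : A)) t = omegaPt K a t ∧
        omegaPt K (star a) t = omegaPt K a t) ∧
    ((∀ t : ℝ, 0 ≤ t → omegaPt K a t = 0) ↔ ∃ c : ℂ, a = c • (1 : A)) ∧
    (∀ t : ℝ, 0 ≤ t → omegaPt K (lam • a) t = ‖lam‖ * omegaPt K a t) ∧
    (∀ t : ℝ, 0 ≤ t → omegaPt K (a + b) t ≤ omegaPt K a t + omegaPt K b t) ∧
    (∀ t : ℝ, 0 ≤ t →
        omegaPt K (a * b) t ≤ ‖a‖ * omegaPt K b t + ‖b‖ * omegaPt K a t) := by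
  refine ⟨fun t ht => ⟨?_, ?_⟩, ⟨fun h => ?_, ?_⟩, fun t ht => omegaPt_smul hK hgen lam a ht,
    fun t ht => ?_, fun t ht => ?_⟩
  · exact omegaPt_congr (fun π π' => by simp [map_add, map_smul]) t
  · exact omegaPt_congr (fun π π' => norm_repSp_star_sub π π' a) t
  · exact exists_eq_smul_one_of_forall_repSp_eq (repSp_eq_of_omegaPt_eq_zero hK hgen h)
  · rintro ⟨c, rfl⟩ t ht
    refine le_antisymm ?_ (omegaPt_nonneg _ ht)
    simpa using omegaPt_le_mul hK hgen (c := c • (1 : A)) (a := 1) le_rfl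
      (fun π π' => by simp) ht
  · simpa using omegaPt_le_add hK hgen (c := a + b) (a := a) (b := b) zero_le_one zero_le_one
      (fun π π' => by
        rw [one_mul, one_mul, map_add, map_add, add_sub_add_comm]
        exact norm_add_le _ _) ht
  · exact omegaPt_le_add hK hgen (norm_nonneg a) (norm_nonneg b)
      (fun π π' => norm_repSp_mul_sub_le π π' a b) ht
end
end

section
/- Let A be a commutative separable unital C*-algebra with compact generating set K. Then the map Φ from the Gelfand spectrum Â of A (with the weak-* topology) to (Rep(A), d_K), defined by Φ(χ)(a) := χ(a)·Id_{ℓ²} for χ ∈ Â and a ∈ A, is a homeomorphism of Â onto Σ(A). -/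
noncomputable section

abbrev lpE (n : ℕ) : Type := lp (fun _ : ℕ => EuclideanSpace ℂ (Fin n)) 2

/-- A representation is irreducible if its commutant is trivial. -/
def IsIrredRep {A : Type*} [CStarAlgebra A] (π : RepSp A) : Prop :=
  ∀ T : BH, (∀ a : A, T * π a = π a * T) → ∃ c : ℂ, T = c • (1 : BH)

/-- `Σ⁰(A)`: irreducible representations on `ℓ²`, together with the countable
amplifications `ℵ₀ ⊙ ρ` of finite-dimensional irreducible representations `ρ`. -/
def Sigma0 (A : Type*) [CStarAlgebra A] : Set (RepSp A) :=
  {π | IsIrredRep π ∨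
    ∃ n : ℕ, 0 < n ∧ ∃ ρ : A →⋆ₐ[ℂ] Matrix (Fin n) (Fin n) ℂ,
      (∀ T : Matrix (Fin n) (Fin n) ℂ, (∀ a : A, T * ρ a = ρ a * T) →
        ∃ c : ℂ, T = c • (1 : Matrix (Fin n) (Fin n) ℂ)) ∧
      ∃ u : H2 ≃ₗᵢ[ℂ] lpE n, ∀ (a : A) (f : lpE n) (k : ℕ),
        u (π a (u.symm f)) k = Matrix.toEuclideanLin (ρ a) (f k)}

/-- `Σ(A)`: the closure of `Σ⁰(A)` with respect to the metric `d_K`. -/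
def SigmaSet {A : Type*} [CStarAlgebra A] (K : Set A) : Set (RepSp A) :=
  {π | ∀ ε > (0 : ℝ), ∃ π' ∈ Sigma0 A, dRep K π π' < ε}

set_option maxHeartbeats 1000000 in
open WeakDual in
/-- The map `Â ∋ χ ↦ (a ↦ χ(a)·Id) ∈ Rep(A)`. -/
def PhiRep {B : Type*} [CommCStarAlgebra B] (χ : characterSpace ℂ B) : RepSp B :=
  (StarAlgHom.ofId ℂ BH).comp
    { WeakDual.CharacterSpace.toAlgHom χ with
      map_star' := fun a => map_star χ a }

open scoped CStarAlgebra in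
theorem continuous_repSp {A : Type*} [CStarAlgebra A] (π : RepSp A) : Continuous π :=
  map_continuous π

theorem Generates.mem_of_isClosed {A : Type*} [CStarAlgebra A] {K : Set A}
    (hgen : Generates K) (S : StarSubalgebra ℂ A) (hKS : K ⊆ S) (hS : IsClosed (S : Set A))
    (a : A) : a ∈ S := by
  have h : (StarAlgebra.adjoin ℂ K).topologicalClosure ≤ S :=
    StarSubalgebra.topologicalClosure_minimal (StarAlgebra.adjoin_le hKS) hS
  rw [hgen] at h
  exact h (by trivial)

theorem norm_sub_le_dRep_s10 {A : Type*} [CStarAlgebra A] {K : Set A} (hK : IsCompact K)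
    (π₁ π₂ : RepSp A) {a : A} (ha : a ∈ K) : ‖π₁ a - π₂ a‖ ≤ dRep K π₁ π₂ := by
  obtain ⟨C, hC⟩ := (hK.image_of_continuousOn
    (f := fun a => ‖π₁ a - π₂ a‖)
    (((continuous_repSp π₁).sub (continuous_repSp π₂)).norm.continuousOn)).bddAbove
  have hC' : ∀ b ∈ K, ‖π₁ b - π₂ b‖ ≤ C := fun b hb => hC ⟨b, hb, rfl⟩
  have hC0 : 0 ≤ C := (norm_nonneg _).trans (hC' a ha)
  have hbdd : BddAbove (Set.range fun b => ⨆ _ : b ∈ K, ‖π₁ b - π₂ b‖) :=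
    ⟨C, by rintro _ ⟨b, rfl⟩; exact Real.iSup_le (fun hb => hC' b hb) hC0⟩
  have h := le_ciSup hbdd a
  simpa [ha, dRep] using h

theorem dRep_le {A : Type*} [CStarAlgebra A] {K : Set A} {π₁ π₂ : RepSp A} {C : ℝ}
    (hC0 : 0 ≤ C) (hC : ∀ a ∈ K, ‖π₁ a - π₂ a‖ ≤ C) : dRep K π₁ π₂ ≤ C :=
  Real.iSup_le (fun a => Real.iSup_le (hC a) hC0) hC0

theorem dRep_nonneg_s10 {A : Type*} [CStarAlgebra A] (K : Set A) (π₁ π₂ : RepSp A) :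
    0 ≤ dRep K π₁ π₂ :=
  Real.iSup_nonneg fun _ => Real.iSup_nonneg fun _ => norm_nonneg _

instance : Nontrivial H2 :=
  ⟨⟨lp.single 2 0 (1 : ℂ), 0, fun h => by
    have := congrArg (fun f : H2 => f 0) h
    simp at this⟩⟩

theorem norm_euclideanSpace_fin_one (x : EuclideanSpace ℂ (Fin 1)) : ‖x‖ = ‖x 0‖ := by
  simp [EuclideanSpace.norm_eq]

/-- The space `ℓ²` is isometric to the `ℓ²`-sum of one-dimensional Hilbert spaces. -/
def lpOneEquiv : H2 ≃ₗᵢ[ℂ] lpE 1 where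
  toFun f := ⟨fun k => EuclideanSpace.single 0 (f k),
    (lp.memℓp f).norm.mono fun k => by simp⟩
  invFun g := ⟨fun k => g k 0,
    (lp.memℓp g).norm.mono fun k => (norm_euclideanSpace_fin_one (g k)).ge⟩
  map_add' f g := by
    refine lp.ext (funext fun k => ?_)
    ext i
    fin_cases i
    change EuclideanSpace.single (0 : Fin 1) (f k + g k) 0
      = EuclideanSpace.single (0 : Fin 1) (f k) 0 + EuclideanSpace.single (0 : Fin 1) (g k) 0
    simp
  map_smul' c f := by
    refine lp.ext (funext fun k => ?_)
    ext i
    fin_cases i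
    simp
  left_inv f := by
    refine lp.ext (funext fun k => ?_)
    simp
  right_inv g := by
    refine lp.ext (funext fun k => ?_)
    ext i
    fin_cases i
    simp
  norm_map' f := by
    simp [lp.norm_eq_tsum_rpow]

theorem PhiRep_apply {A : Type*} [CommCStarAlgebra A] (χ : WeakDual.characterSpace ℂ A) (a : A) :
    PhiRep χ a = χ a • (1 : BH) :=
  Algebra.algebraMap_eq_smul_one (A := BH) (χ a)

theorem norm_PhiRep_sub {A : Type*} [CommCStarAlgebra A] (χ χ' : WeakDual.characterSpace ℂ A)
    (a : A) : ‖PhiRep χ a - PhiRep χ' a‖ = ‖χ a - χ' a‖ := by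
  rw [PhiRep_apply, PhiRep_apply, ← sub_smul, norm_smul, norm_one, mul_one]

theorem PhiRep_injective {A : Type*} [CommCStarAlgebra A] :
    Function.Injective fun χ : WeakDual.characterSpace ℂ A => PhiRep χ := by
  intro χ χ' h
  refine DFunLike.ext _ _ fun a => ?_
  have := norm_PhiRep_sub χ χ' a
  simp only at h
  rw [h, sub_self, norm_zero] at this
  exact sub_eq_zero.mp (norm_eq_zero.mp this.symm)

theorem PhiRep_mem_Sigma0 {A : Type*} [CommCStarAlgebra A] (χ : WeakDual.characterSpace ℂ A) :
    PhiRep χ ∈ Sigma0 A := by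
  refine Or.inr ⟨1, one_pos, (StarAlgHom.ofId ℂ (Matrix (Fin 1) (Fin 1) ℂ)).comp
    { WeakDual.CharacterSpace.toAlgHom χ with map_star' := fun a => map_star χ a }, ?_,
    lpOneEquiv, ?_⟩
  · intro T _
    refine ⟨T 0 0, ?_⟩
    ext i j
    fin_cases i; fin_cases j; simp
  · intro a f k
    rw [PhiRep_apply]
    have : ((StarAlgHom.ofId ℂ (Matrix (Fin 1) (Fin 1) ℂ)).comp
      { WeakDual.CharacterSpace.toAlgHom χ with map_star' := fun a => map_star χ a }) a
        = χ a • (1 : Matrix (Fin 1) (Fin 1) ℂ) :=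
      Algebra.algebraMap_eq_smul_one (A := Matrix (Fin 1) (Fin 1) ℂ) (χ a)
    rw [this]
    simp [Matrix.toLpLin_one]

/-- In the commutative case all members of `Σ⁰(A)` take scalar values. -/
theorem apply_mem_bot_of_mem_Sigma0 {A : Type*} [CommCStarAlgebra A] {π : RepSp A}
    (hπ : π ∈ Sigma0 A) (a : A) : π a ∈ (⊥ : StarSubalgebra ℂ BH) := by
  rw [StarSubalgebra.mem_bot]
  simp only [Set.mem_range, Algebra.algebraMap_eq_smul_one]
  rcases hπ with h | ⟨n, -, ρ, hρ, u, hu⟩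
  · obtain ⟨c, hc⟩ := h (π a) fun b => by rw [← map_mul, mul_comm, map_mul]
    exact ⟨c, hc.symm⟩
  · obtain ⟨c, hc⟩ := hρ (ρ a) fun b => by rw [← map_mul, mul_comm, map_mul]
    refine ⟨c, ContinuousLinearMap.ext fun x => u.injective ?_⟩
    refine lp.ext (funext fun k => ?_)
    have := hu a (u x) k
    rw [hc] at this
    simp [Matrix.toLpLin_one] at this
    simp [this]

theorem isClosed_bot_BH : IsClosed ((⊥ : StarSubalgebra ℂ BH) : Set BH) := by
  have := (LinearMap.range (Algebra.linearMap ℂ BH)).closed_of_finiteDimensional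
  convert this using 1
  ext x
  simp

theorem apply_mem_bot_of_mem_SigmaSet {A : Type*} [CommCStarAlgebra A] {K : Set A}
    (hK : IsCompact K) (hgen : Generates K) {π : RepSp A} (hπ : π ∈ SigmaSet K) (a : A) :
    π a ∈ (⊥ : StarSubalgebra ℂ BH) := by
  refine hgen.mem_of_isClosed ((⊥ : StarSubalgebra ℂ BH).comap π) (fun b hb => ?_)
    (isClosed_bot_BH.preimage (continuous_repSp π)) a
  refine isClosed_bot_BH.closure_subset (Metric.mem_closure_iff.mpr fun ε hε => ?_)
  obtain ⟨π', hπ', hlt⟩ := hπ ε hε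
  exact ⟨π' b, apply_mem_bot_of_mem_Sigma0 hπ' b,
    (dist_eq_norm _ _).trans_lt ((norm_sub_le_dRep_s10 hK π π' hb).trans_lt hlt)⟩

theorem exists_PhiRep_eq {A : Type*} [CommCStarAlgebra A] {π : RepSp A}
    (hπ : ∀ a, π a ∈ (⊥ : StarSubalgebra ℂ BH)) :
    ∃ χ : WeakDual.characterSpace ℂ A, PhiRep χ = π := by
  let f : A →ₐ[ℂ] ℂ := (Algebra.botEquiv ℂ BH).toAlgHom.comp
    (π.toAlgHom.codRestrict ⊥ hπ)
  refine ⟨WeakDual.CharacterSpace.equivAlgHom.symm f, StarAlgHom.ext fun a => ?_⟩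
  rw [PhiRep_apply, ← Algebra.algebraMap_eq_smul_one]
  have := congrArg Subtype.val
    ((Algebra.botEquiv ℂ BH).symm_apply_apply (π.toAlgHom.codRestrict ⊥ hπ a))
  exact this

theorem continuous_characterSpace_eval {A : Type*} [CommCStarAlgebra A] :
    Continuous fun p : WeakDual.characterSpace ℂ A × A => p.1 p.2 := by
  have h : Continuous (WeakDual.gelfandTransform ℂ A) := 
    (gelfandTransform_isometry A).continuous
  exact (continuous_eval (F := C(WeakDual.characterSpace ℂ A, ℂ))).comp ((h.comp continuous_snd).prodMk continuous_fst)

theorem tendsto_dRep_PhiRep {A : Type*} [CommCStarAlgebra A] {K : Set A} (hK : IsCompact K)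
    (χ : WeakDual.characterSpace ℂ A) :
    Filter.Tendsto (fun χ' : WeakDual.characterSpace ℂ A => dRep K (PhiRep χ') (PhiRep χ))
      (nhds χ) (nhds 0) := by
  rw [Metric.tendsto_nhds]
  intro ε hε
  have hcont : Continuous fun p : WeakDual.characterSpace ℂ A × A => ‖p.1 p.2 - χ p.2‖ :=
    (continuous_characterSpace_eval.sub
      (continuous_characterSpace_eval.comp (continuous_const.prodMk continuous_snd))).norm
  have h := hK.eventually_forall_of_forall_eventually (x₀ := χ)
    (P := fun χ' a => ‖χ' a - χ a‖ < ε / 2) fun a _ =>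
      hcont.continuousAt.eventually_lt continuousAt_const (by simpa using hε)
  filter_upwards [h] with χ' hχ'
  rw [Real.dist_0_eq_abs, abs_of_nonneg (dRep_nonneg_s10 _ _ _)]
  refine (dRep_le (half_pos hε).le fun a ha => ?_).trans_lt (half_lt_self hε)
  rw [norm_PhiRep_sub]
  exact (hχ' a ha).le

theorem eq_of_eqOn_generators {A : Type*} [CommCStarAlgebra A] {K : Set A} (hgen : Generates K)
    {χ χ' : WeakDual.characterSpace ℂ A} (h : ∀ a ∈ K, χ a = χ' a) : χ = χ' := by
  refine PhiRep_injective (StarAlgHom.ext fun a => ?_)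
  refine hgen.mem_of_isClosed (StarAlgHom.equalizer (PhiRep χ) (PhiRep χ')) (fun b hb => ?_)
    (isClosed_eq (continuous_repSp (PhiRep χ)) (continuous_repSp (PhiRep χ'))) a
  change PhiRep χ b = PhiRep χ' b
  rw [PhiRep_apply, PhiRep_apply, h b hb]

theorem comap_dRep_le_nhds {A : Type*} [CommCStarAlgebra A] {K : Set A} (hK : IsCompact K)
    (hgen : Generates K) (χ : WeakDual.characterSpace ℂ A) :
    Filter.comap (fun χ' => dRep K (PhiRep χ') (PhiRep χ)) (nhds 0) ≤ nhds χ := by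
  refine le_nhds_of_unique_clusterPt fun y hy => eq_of_eqOn_generators hgen fun a ha => ?_
  have hcont : Continuous fun χ' : WeakDual.characterSpace ℂ A => ‖χ' a - χ a‖ :=
    ((continuous_characterSpace_eval.comp (continuous_id.prodMk continuous_const)).sub
      continuous_const).norm
  have h0 : Filter.Tendsto (fun χ' : WeakDual.characterSpace ℂ A => ‖χ' a - χ a‖)
      (Filter.comap (fun χ' => dRep K (PhiRep χ') (PhiRep χ)) (nhds 0)) (nhds 0) :=
    squeeze_zero (fun _ => norm_nonneg _)
      (fun χ' => (norm_PhiRep_sub χ' χ a).symm.trans_le (norm_sub_le_dRep_s10 hK _ _ ha))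
      Filter.tendsto_comap
  have : (nhds y ⊓ Filter.comap (fun χ' => dRep K (PhiRep χ') (PhiRep χ)) (nhds 0)).NeBot := hy
  have := tendsto_nhds_unique ((hcont.tendsto y).mono_left inf_le_left)
    (h0.mono_left inf_le_right)
  exact sub_eq_zero.mp (norm_eq_zero.mp this)

open WeakDual in
theorem stmt10 (A : Type*) [CommCStarAlgebra A] [TopologicalSpace.SeparableSpace A]
    (K : Set A) (hK : IsCompact K) (hgen : Generates K) :
    (∀ (χ : characterSpace ℂ A) (a : A), PhiRep χ a = χ a • (1 : BH)) ∧
    -- Φ maps `Â` into `Σ(A)`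
    (∀ χ : characterSpace ℂ A, PhiRep χ ∈ SigmaSet K) ∧
    -- Φ is injective
    (Function.Injective fun χ : characterSpace ℂ A => PhiRep χ) ∧
    -- Φ is onto `Σ(A)`
    (∀ π ∈ SigmaSet (A := A) K, ∃ χ : characterSpace ℂ A, PhiRep χ = π) ∧
    -- Φ is continuous from the weak-* topology to the metric `d_K`
    (∀ χ : characterSpace ℂ A,
      Filter.Tendsto (fun χ' : characterSpace ℂ A => dRep K (PhiRep χ') (PhiRep χ))
        (nhds χ) (nhds 0)) ∧
    -- the inverse of Φ is continuous from the metric `d_K` to the weak-* topology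
    (∀ χ : characterSpace ℂ A, ∀ U ∈ nhds χ, ∃ δ > (0 : ℝ),
      ∀ χ' : characterSpace ℂ A, dRep K (PhiRep χ') (PhiRep χ) < δ → χ' ∈ U) := by
  refine ⟨PhiRep_apply, fun χ ε hε => ⟨PhiRep χ, PhiRep_mem_Sigma0 χ, ?_⟩, PhiRep_injective,
    fun π hπ => exists_PhiRep_eq (apply_mem_bot_of_mem_SigmaSet hK hgen hπ),
    tendsto_dRep_PhiRep hK, fun χ U hU => ?_⟩
  · exact (dRep_le le_rfl fun a _ => by simp).trans_lt hε
  · obtain ⟨δ, hδ, h⟩ := (Metric.nhds_basis_ball.comap _).mem_iff.mp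
      (comap_dRep_le_nhds hK hgen χ hU)
    refine ⟨δ, hδ, fun χ' hχ' => h ?_⟩
    simpa [abs_of_nonneg (dRep_nonneg_s10 _ _ _)] using hχ'
end
end
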